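/- arXiv:math/0004140 — 8 statements merged into one kernel-verified Lean document; each statement's English description precedes it below -/
import Mathlib

section
/- Let X be an h-homogeneous compact Hausdorff space and let G = Aut(X) be the group of self-homeomorphisms of X with the compact-open topology. Then G is Roelcke-precompact: for every neighborhood U of the identity in G there exists a finite set F ⊆ G such that U·F·U = G, i.e. every h ∈ G can be written as h = u ∘ f ∘ v with u, v ∈ U and f ∈ F. -/
open Set TopologicalSpace Filter

/-- A compact Hausdorff space is h-homogeneous if it is nonempty, zero-dimensional
(clopen sets form a basis) and all nonempty clopen subsets are homeomorphic. -/
def IsHHomogeneous (X : Type*) [TopologicalSpace X] : Prop :=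
  Nonempty X ∧ IsTopologicalBasis {s : Set X | IsClopen s} ∧
    ∀ U V : Set X, IsClopen U → IsClopen V → U.Nonempty → V.Nonempty → Nonempty (U ≃ₜ V)

/-- The group of self-homeomorphisms, with `(f * g) x = f (g x)`. -/
instance homeoGroup (X : Type*) [TopologicalSpace X] : Group (X ≃ₜ X) where
  mul f g := g.trans f
  one := Homeomorph.refl X
  inv := Homeomorph.symm
  mul_assoc f g h := Homeomorph.ext fun _ => rfl
  one_mul f := Homeomorph.ext fun _ => rfl
  mul_one f := Homeomorph.ext fun _ => rfl
  inv_mul_cancel f := Homeomorph.ext fun x => f.symm_apply_apply x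

/-- The compact-open topology on the group of self-homeomorphisms. -/
instance homeoTop (X : Type*) [TopologicalSpace X] : TopologicalSpace (X ≃ₜ X) :=
  TopologicalSpace.induced (fun f => (f : C(X, X))) ContinuousMap.compactOpen


theorem hh_clopen_between {X : Type*} [TopologicalSpace X] [CompactSpace X] [T2Space X]
    (hB : IsTopologicalBasis {s : Set X | IsClopen s}) {K V : Set X}
    (hK : IsCompact K) (hV : IsOpen V) (hKV : K ⊆ V) :
    ∃ C : Set X, IsClopen C ∧ K ⊆ C ∧ C ⊆ V := by
  refine hK.induction_on (p := fun s => ∃ C : Set X, IsClopen C ∧ s ⊆ C ∧ C ⊆ V) ?_ ?_ ?_ ?_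
  · exact ⟨∅, isClopen_empty, subset_rfl, empty_subset _⟩
  · rintro s t hst ⟨C, h1, h2, h3⟩
    exact ⟨C, h1, hst.trans h2, h3⟩
  · rintro s t ⟨C, h1, h2, h3⟩ ⟨D, k1, k2, k3⟩
    exact ⟨C ∪ D, h1.union k1, union_subset_union h2 k2, union_subset h3 k3⟩
  · intro x hx
    obtain ⟨C, hC, hxC, hCV⟩ := hB.exists_subset_of_mem_open (hKV hx) hV
    exact ⟨C, mem_nhdsWithin_of_mem_nhds (hC.isOpen.mem_nhds hxC), C, hC, subset_rfl, hCV⟩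

theorem hh_partition {X : Type*} [TopologicalSpace X] [CompactSpace X] [T2Space X]
    (hB : IsTopologicalBasis {s : Set X | IsClopen s})
    (U : Set (X ≃ₜ X)) (hU : U ∈ nhds (1 : X ≃ₜ X)) :
    ∃ S : Set {C : Set X // IsClopen C}, S.Finite ∧
      ∀ g : X ≃ₜ X, (∀ C ∈ S, ∀ x, g x ∈ C.1 ↔ x ∈ C.1) → g ∈ U := by
  have key : (⨅ C : {C : Set X // IsClopen C},
      𝓟 {g : X ≃ₜ X | ∀ x, g x ∈ C.1 ↔ x ∈ C.1}) ≤ nhds (1 : X ≃ₜ X) := by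
    rw [nhds_induced, ContinuousMap.nhds_compactOpen]
    simp only [comap_iInf, comap_principal, le_iInf_iff]
    intro K hK V hV hKV
    obtain ⟨C, hC, h1, h2⟩ := hh_clopen_between hB hK hV (fun x hx => hKV hx)
    refine iInf_le_of_le ⟨C, hC⟩ ?_
    rw [principal_mono]
    intro g hg x hx
    exact h2 ((hg x).2 (h1 hx))
  obtain ⟨S, hS, h⟩ := (hasBasis_iInf_principal_finite _).mem_iff.1 (key hU)
  refine ⟨S, hS, fun g hg => h ?_⟩
  simpa using fun a b c => hg ⟨a, b⟩ c

theorem hh_lift {X K : Type*} [TopologicalSpace X] [CompactSpace X] [T2Space X]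
    [TopologicalSpace K] [DiscreteTopology K]
    (hX : IsHHomogeneous X) (q r : X → K) (hq : Continuous q) (hr : Continuous r)
    (h : range q = range r) : ∃ v : X ≃ₜ X, ∀ x, r (v x) = q x := by
  have e : ∀ k, Nonempty ({x // q x = k} ≃ₜ {x // r x = k}) := by
    intro k
    have cq : IsClopen {x | q x = k} := (isClopen_discrete {k}).preimage hq
    have cr : IsClopen {x | r x = k} := (isClopen_discrete {k}).preimage hr
    by_cases hk : k ∈ range q
    · exact hX.2.2 _ _ cq cr hk (show k ∈ range r from h ▸ hk)
    · have hk' : k ∉ range r := h ▸ hk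
      have : IsEmpty {x // q x = k} := ⟨fun x => hk ⟨x.1, x.2⟩⟩
      have : IsEmpty {x // r x = k} := ⟨fun x => hk' ⟨x.1, x.2⟩⟩
      exact ⟨Homeomorph.empty⟩
  replace e := fun k => (e k).some
  let E : X ≃ X := ((Equiv.sigmaFiberEquiv q).symm.trans
    (Equiv.sigmaCongrRight fun k => (e k).toEquiv)).trans (Equiv.sigmaFiberEquiv r)
  have hE : ∀ k (x : {x // q x = k}), E x = e k x := by
    rintro k ⟨x, rfl⟩
    rfl
  have hc : Continuous E := by
    rw [continuous_iff_continuousAt]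
    intro x
    have cq : IsOpen {y | q y = q x} := (isOpen_discrete {q x}).preimage hq
    have : ContinuousOn E {y | q y = q x} := by
      rw [continuousOn_iff_continuous_domRestrict]
      have : domRestrict {y | q y = q x} E = fun y => (e (q x) y : X) := by
        funext y
        exact hE _ y
      rw [this]
      exact continuous_subtype_val.comp (e (q x)).continuous
    exact this.continuousAt (cq.mem_nhds rfl)
  refine ⟨hc.homeoOfEquivCompactToT2, fun x => ?_⟩
  exact (e (q x) ⟨x, rfl⟩).2

/-- The group of self-homeomorphisms of an h-homogeneous compact Hausdorff space,
with the compact-open topology, is Roelcke-precompact: for every neighborhood `U`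
of the identity there is a finite set `F` with `U * F * U = G`. -/
theorem roelcke_precompact_of_isHHomogeneous
    {X : Type*} [TopologicalSpace X] [CompactSpace X] [T2Space X]
    (hX : IsHHomogeneous X)
    (U : Set (X ≃ₜ X)) (hU : U ∈ nhds (1 : X ≃ₜ X)) :
    ∃ F : Finset (X ≃ₜ X), ∀ h : X ≃ₜ X, ∃ u ∈ U, ∃ f ∈ F, ∃ v ∈ U, h = u * f * v := by
  classical
  obtain ⟨S, hS, hSU⟩ := hh_partition hX.2.1 U hU
  have := hS.to_subtype
  let p : X → (S → Bool) := fun x C => decide (x ∈ C.1.1)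
  have hp : Continuous p := by
    refine continuous_pi fun C => ?_
    refine (continuous_bool_rng true).2 ?_
    convert C.1.2 using 1
    ext x
    simp [p]
  have hpU : ∀ g : X ≃ₜ X, (∀ x, p (g x) = p x) → g ∈ U := by
    intro g hg
    refine hSU g fun C hC x => ?_
    have := congrFun (hg x) ⟨C, hC⟩
    simpa [p] using this
  let τ : (X ≃ₜ X) → Set ((S → Bool) × (S → Bool)) := fun h => range fun x => (p x, p (h x))
  have hfin : (range τ).Finite := toFinite _
  choose s hs using fun t : range τ => t.2
  have : Finite (range τ) := hfin
  refine ⟨(finite_range s).toFinset, fun h => ?_⟩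
  let f := s ⟨τ h, h, rfl⟩
  have hf : τ f = τ h := hs ⟨τ h, h, rfl⟩
  obtain ⟨v, hv⟩ := hh_lift hX (fun x => (p x, p (h x))) (fun x => (p x, p (f x)))
    (hp.prodMk (hp.comp h.continuous)) (hp.prodMk (hp.comp f.continuous)) hf.symm
  refine ⟨h * v⁻¹ * f⁻¹, hpU _ fun y => ?_, f, by simp [f], v, hpU _ fun x => ?_, ?_⟩
  · have := congrArg Prod.snd (hv (v.symm (f.symm y)))
    simp only [Homeomorph.apply_symm_apply] at this
    exact this.symm
  · exact congrArg Prod.fst (hv x)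
  · group
end

section
/- Let X be a compact metric space. Then the set E₀(X) of all nonempty closed relations R ⊆ X × X with Dom R = Ran R = X is a closed (hence compact) subset of the space of nonempty compact subsets of X × X equipped with the Hausdorff metric; moreover E₀(X) is closed under composition of relations and under taking inverse relations. -/
open Set TopologicalSpace Filter

/-- Composition of relations: `relComp R S = {(x,y) : ∃ z, (x,z) ∈ S ∧ (z,y) ∈ R}`. -/
def relComp {K : Type*} (R S : Set (K × K)) : Set (K × K) :=
  {p | ∃ z, (p.1, z) ∈ S ∧ (z, p.2) ∈ R}

/-- `E₀(X)`: the set of nonempty compact (= closed) relations on `X` with full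
domain and range, viewed inside the hyperspace of nonempty compact subsets of `X × X`. -/
def E0 (X : Type*) [TopologicalSpace X] : Set (NonemptyCompacts (X × X)) :=
  {R | (∀ x : X, ∃ y : X, (x, y) ∈ (R : Set (X × X))) ∧
    ∀ y : X, ∃ x : X, (x, y) ∈ (R : Set (X × X))}

theorem E0_isClosed_and_closed_under_comp_and_inv
    (X : Type*) [MetricSpace X] [CompactSpace X] :
    IsClosed (E0 X) ∧
    (∀ R ∈ E0 X, ∀ S ∈ E0 X, ∃ T ∈ E0 X,
      (T : Set (X × X)) = relComp (R : Set (X × X)) (S : Set (X × X))) ∧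
    (∀ R ∈ E0 X, ∃ T ∈ E0 X, (T : Set (X × X)) = Prod.swap '' (R : Set (X × X))) := by
  refine ⟨?_, ?_, ?_⟩
  · have h : E0 X = (⋂ x : X, {R : NonemptyCompacts (X × X) |
          ((R : Set (X × X)) ∩ {p | p.1 = x}).Nonempty}) ∩
        ⋂ y : X, {R : NonemptyCompacts (X × X) |
          ((R : Set (X × X)) ∩ {p | p.2 = y}).Nonempty} := by
      ext R
      simp only [E0, mem_inter_iff, mem_iInter, Set.mem_setOf_eq, Set.Nonempty, Prod.exists]
      constructor
      · rintro ⟨h1, h2⟩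
        exact ⟨fun x => let ⟨y, hy⟩ := h1 x; ⟨x, y, hy, rfl⟩,
          fun y => let ⟨x, hx⟩ := h2 y; ⟨x, y, hx, rfl⟩⟩
      · rintro ⟨h1, h2⟩
        refine ⟨fun x => ?_, fun y => ?_⟩
        · obtain ⟨a, b, hab, rfl⟩ := h1 x
          exact ⟨b, hab⟩
        · obtain ⟨a, b, hab, rfl⟩ := h2 y
          exact ⟨a, hab⟩
    rw [h]
    refine (isClosed_iInter fun x => ?_).inter (isClosed_iInter fun y => ?_)
    · exact NonemptyCompacts.isClosed_inter_nonempty_of_isClosed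
        (isClosed_eq continuous_fst continuous_const)
    · exact NonemptyCompacts.isClosed_inter_nonempty_of_isClosed
        (isClosed_eq continuous_snd continuous_const)
  · rintro R ⟨hR1, hR2⟩ S ⟨hS1, hS2⟩
    have hc : IsCompact (relComp (R : Set (X × X)) (S : Set (X × X))) := by
      have e : relComp (R : Set (X × X)) (S : Set (X × X)) =
          (fun q : X × X × X => (q.1, q.2.2)) ''
            ({q | (q.1, q.2.1) ∈ (S : Set (X × X))} ∩
              {q | (q.2.1, q.2.2) ∈ (R : Set (X × X))}) := by
        ext ⟨x, y⟩
        constructor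
        · rintro ⟨z, h1, h2⟩
          exact ⟨(x, z, y), ⟨h1, h2⟩, rfl⟩
        · rintro ⟨⟨a, z, b⟩, ⟨h1, h2⟩, h⟩
          obtain ⟨rfl, rfl⟩ := Prod.mk.inj h
          exact ⟨z, h1, h2⟩
      rw [e]
      refine IsCompact.image (IsClosed.isCompact (IsClosed.inter ?_ ?_)) (by fun_prop)
      · exact S.isCompact.isClosed.preimage
          (f := fun q : X × X × X => (q.1, q.2.1)) (by fun_prop)
      · exact R.isCompact.isClosed.preimage
          (f := fun q : X × X × X => (q.2.1, q.2.2)) (by fun_prop)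
    have hne : (relComp (R : Set (X × X)) (S : Set (X × X))).Nonempty := by
      obtain ⟨⟨x, z⟩, h⟩ := S.nonempty
      obtain ⟨y, hy⟩ := hR1 z
      exact ⟨(x, y), z, h, hy⟩
    refine ⟨⟨⟨_, hc⟩, hne⟩, ⟨fun x => ?_, fun y => ?_⟩, rfl⟩
    · obtain ⟨z, hz⟩ := hS1 x
      obtain ⟨y, hy⟩ := hR1 z
      exact ⟨y, z, hz, hy⟩
    · obtain ⟨z, hz⟩ := hR2 y
      obtain ⟨x, hx⟩ := hS2 z
      exact ⟨x, z, hx, hz⟩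
  · rintro R ⟨hR1, hR2⟩
    refine ⟨⟨⟨_, R.isCompact.image continuous_swap⟩, R.nonempty.image _⟩,
      ⟨fun x => ?_, fun y => ?_⟩, rfl⟩
    · obtain ⟨z, hz⟩ := hR2 x
      exact ⟨z, _, hz, rfl⟩
    · obtain ⟨z, hz⟩ := hR1 y
      exact ⟨z, _, hz, rfl⟩
end

section
/- Let X be a compact metrizable h-homogeneous space with a compatible metric. Then the set {graph f : f ∈ Aut(X)} of graphs of self-homeomorphisms of X is dense in E₀(X) with respect to the Hausdorff metric on nonempty compact subsets of X × X; in fact the closure of {graph f : f ∈ Aut(X)} equals E₀(X). -/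
open Set TopologicalSpace Filter

theorem hh_glue {X G : Type*} [TopologicalSpace X] [CompactSpace X] [T2Space X]
    (a b : X → G) (ha : IsLocallyConstant a)
    (h : ∀ g, Nonempty ({x | a x = g} ≃ₜ {x | b x = g})) :
    ∃ f : X ≃ₜ X, ∀ x, b (f x) = a x := by
  let e := fun g => (h g).some
  let f : X → X := fun x => (e (a x) ⟨x, rfl⟩ : X)
  have hf : ∀ g (z : {x | a x = g}), f z = e g z := by
    rintro g ⟨x, rfl⟩
    rfl
  have hb : ∀ x, b (f x) = a x := fun x => (e (a x) ⟨x, rfl⟩).2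
  have hc : Continuous f := by
    rw [continuous_iff_continuousAt]
    intro x
    have ho : IsOpen {y | a y = a x} := ha.isOpen_fiber (a x)
    have : ContinuousOn f {y | a y = a x} := by
      rw [continuousOn_iff_continuous_domRestrict]
      have : ({y | a y = a x} : Set X).domRestrict f = fun z => (e (a x) z : X) := by
        funext z
        exact hf _ z
      rw [this]
      exact continuous_subtype_val.comp (e (a x)).continuous
    exact this.continuousAt (ho.mem_nhds rfl)
  have hbij : Function.Bijective f := by
    constructor
    · intro x y hxy
      have h1 : a x = a y := by rw [← hb, ← hb, hxy]
      have h2 := hf (a y) ⟨x, h1⟩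
      have h3 := hf (a y) ⟨y, rfl⟩
      have h4 : e (a y) ⟨x, h1⟩ = e (a y) ⟨y, rfl⟩ := by
        apply Subtype.ext
        rw [← h2, ← h3]; exact hxy
      exact congrArg Subtype.val ((e (a y)).injective h4)
    · intro y
      refine ⟨(e (b y)).symm ⟨y, rfl⟩, ?_⟩
      rw [hf]; simp
  exact ⟨Continuous.homeoOfEquivCompactToT2 (f := Equiv.ofBijective f hbij) hc, hb⟩

theorem hh_split {X : Type*} [TopologicalSpace X] [T2Space X]
    (hX : IsHHomogeneous X) [Nontrivial X] (n : ℕ) :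
    ∀ U : Set X, IsClopen U → U.Nonempty →
      ∃ f : X → ℕ, IsLocallyConstant f ∧ ∀ k ≤ n, ∃ x ∈ U, f x = k := by
  induction n with
  | zero =>
    rintro U hU ⟨x, hx⟩
    exact ⟨fun _ => 0, IsLocallyConstant.const 0, fun k hk => ⟨x, hx, (Nat.le_zero.1 hk).symm⟩⟩
  | succ n ih =>
    intro U hU hne
    obtain ⟨e⟩ := hX.2.2 U univ hU isClopen_univ hne univ_nonempty
    obtain ⟨p, q, hpq⟩ := exists_pair_ne X
    have hxy : (e.symm ⟨p, trivial⟩ : X) ≠ e.symm ⟨q, trivial⟩ := by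
      intro h
      have := e.symm.injective (Subtype.ext h)
      exact hpq (congrArg Subtype.val this)
    obtain ⟨x, hx, y, hy, hxy⟩ : ∃ x ∈ U, ∃ y ∈ U, x ≠ y :=
      ⟨_, (e.symm ⟨p, trivial⟩).2, _, (e.symm ⟨q, trivial⟩).2, hxy⟩
    obtain ⟨V, hV, hxV, hVs⟩ := hX.2.1.exists_subset_of_mem_open
      (show x ∈ U ∩ {y}ᶜ from ⟨hx, hxy⟩) (hU.isOpen.inter isOpen_compl_singleton)
    obtain ⟨f, hf, hfn⟩ := ih V hV ⟨x, hxV⟩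
    classical
    refine ⟨fun z => if z ∈ V then f z else n + 1, ?_, ?_⟩
    · rw [IsLocallyConstant.iff_eventually_eq]
      intro z
      by_cases hz : z ∈ V
      · filter_upwards [hV.isOpen.mem_nhds hz, hf.eventually_eq z] with w hw hw'
        simp [hw, hz, hw']
      · filter_upwards [hV.compl.isOpen.mem_nhds hz] with w hw
        have : w ∉ V := hw
        simp [this, hz]
    · intro k hk
      rcases Nat.lt_or_ge n k with h | h
      · refine ⟨y, hy, ?_⟩
        have : y ∉ V := fun h => (hVs h).2 rfl
        simp only [this, if_false]; omega
      · obtain ⟨z, hz, hzk⟩ := hfn k h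
        exact ⟨z, (hVs hz).1, by simp [hz, hzk]⟩

theorem hh_lift_s2 {X : Type*} [TopologicalSpace X] [T2Space X]
    (hX : IsHHomogeneous X) [Nontrivial X] {I G : Type*} [Finite G]
    (p : X → I) (hp : IsLocallyConstant p) (π : G → I)
    (h1 : ∀ x, ∃ g, π g = p x) (h2 : ∀ g, ∃ x, p x = π g) :
    ∃ a : X → G, IsLocallyConstant a ∧ (∀ x, π (a x) = p x) ∧ Function.Surjective a := by
  have key : ∀ x : X, ∃ s : X → {g // π g = p x}, IsLocallyConstant s ∧
      ∀ g, ∃ z, p z = p x ∧ s z = g := by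
    intro x
    obtain ⟨g0, hg0⟩ := h1 x
    obtain ⟨n, ⟨e⟩⟩ := Finite.exists_equiv_fin {g // π g = p x}
    obtain ⟨f, hf, hfn⟩ := hh_split hX n {z | p z = p x} (hp.isClopen_fiber _) ⟨x, rfl⟩
    refine ⟨(fun k => if hk : k < n then e.symm ⟨k, hk⟩ else ⟨g0, hg0⟩) ∘ f, hf.comp _, ?_⟩
    intro g
    obtain ⟨z, hz, hzk⟩ := hfn (e g) (e g).2.le
    exact ⟨z, hz, by simp [hzk]⟩
  have key' : ∀ i : range p, ∃ s : X → {g // π g = i}, IsLocallyConstant s ∧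
      ∀ g, ∃ z, p z = i ∧ s z = g := by
    rintro ⟨_, x, rfl⟩
    exact key x
  choose s hs hs' using key'
  have hs2 : ∀ (i j : range p) (x : X), i = j → (s i x).1 = (s j x).1 := by
    rintro i _ x rfl
    rfl
  refine ⟨fun x => (s ⟨p x, x, rfl⟩ x).1, ?_, fun x => (s ⟨p x, x, rfl⟩ x).2, ?_⟩
  · rw [IsLocallyConstant.iff_eventually_eq]
    intro x
    filter_upwards [hp.eventually_eq x, (hs ⟨p x, x, rfl⟩).eventually_eq x] with y hy hy'
    have hh : (⟨p y, y, rfl⟩ : range p) = ⟨p x, x, rfl⟩ := Subtype.ext hy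
    exact (hs2 _ _ y hh).trans (congrArg Subtype.val hy')
  · intro g
    obtain ⟨x, hx⟩ := h2 g
    obtain ⟨z, hz, hz'⟩ := hs' ⟨p x, x, rfl⟩ ⟨g, hx.symm⟩
    refine ⟨z, ?_⟩
    have hh : (⟨p z, z, rfl⟩ : range p) = ⟨p x, x, rfl⟩ := Subtype.ext hz
    exact (hs2 _ _ z hh).trans (congrArg Subtype.val hz')

theorem hh_part {X : Type*} [MetricSpace X] [CompactSpace X] (hX : IsHHomogeneous X)
    (ε : ℝ) (hε : 0 < ε) :
    ∃ (t : Finset X) (p : X → Set t), IsLocallyConstant p ∧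
      ∀ x y, p x = p y → dist x y < ε := by
  have h : ∀ x : X, ∃ V : Set X, IsClopen V ∧ x ∈ V ∧ V ⊆ Metric.ball x (ε / 2) := by
    intro x
    obtain ⟨V, hV, h1, h2⟩ := hX.2.1.exists_subset_of_mem_open
      (Metric.mem_ball_self (half_pos hε) : x ∈ Metric.ball x (ε / 2)) Metric.isOpen_ball
    exact ⟨V, hV, h1, h2⟩
  choose V hV hxV hVb using h
  obtain ⟨t, ht⟩ := isCompact_univ.elim_finite_subcover V (fun x => (hV x).isOpen)
    (fun x _ => mem_iUnion.2 ⟨x, hxV x⟩)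
  refine ⟨t, fun x => {i | x ∈ V i}, ?_, ?_⟩
  · rw [IsLocallyConstant.iff_eventually_eq]
    intro x
    have : ∀ i : t, ∀ᶠ y in nhds x, (y ∈ V i ↔ x ∈ V i) := by
      intro i
      by_cases hx : x ∈ V i
      · filter_upwards [(hV i).isOpen.mem_nhds hx] with y hy
        simp [hx, hy]
      · filter_upwards [(hV i).compl.isOpen.mem_nhds hx] with y hy
        have : y ∉ V i := hy
        simp [hx, this]
    filter_upwards [eventually_all.2 this] with y hy
    ext i
    exact hy i
  · intro x y hxy
    obtain ⟨i, hi, hxi⟩ := mem_iUnion₂.1 (ht (mem_univ x))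
    have hyi : y ∈ V i := by
      have : (⟨i, hi⟩ : t) ∈ {i : t | x ∈ V i} := hxi
      exact (Set.ext_iff.1 hxy ⟨i, hi⟩).1 this
    have h1 := hVb i hxi
    have h2 := hVb i hyi
    rw [Metric.mem_ball] at h1 h2
    have := dist_triangle_right x y i
    linarith

theorem closure_graphs_eq_E0
    {X : Type*} [MetricSpace X] [CompactSpace X] (hX : IsHHomogeneous X) :
    closure {K : NonemptyCompacts (X × X) |
        ∃ f : X ≃ₜ X, (K : Set (X × X)) = {p : X × X | p.2 = f p.1}} = E0 X := by
  have : Nonempty X := hX.1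
  apply Subset.antisymm
  · apply closure_minimal
    · rintro K ⟨f, hf⟩
      refine ⟨fun x => ⟨f x, ?_⟩, fun y => ⟨f.symm y, ?_⟩⟩ <;> rw [hf] <;> simp
    · have hE : E0 X = {K | K.map Prod.fst continuous_fst = ⊤} ∩
          {K | K.map Prod.snd continuous_snd = ⊤} := by
        ext K
        simp only [E0, mem_inter_iff, mem_ofPred_eq, ← SetLike.coe_set_eq,
          NonemptyCompacts.coe_map, NonemptyCompacts.coe_top, eq_univ_iff_forall, mem_image,
          Prod.exists, exists_and_right, exists_eq_right]
      rw [hE]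
      exact (isClosed_eq (Continuous.nonemptyCompacts_map continuous_fst)
        continuous_const).inter (isClosed_eq (Continuous.nonemptyCompacts_map continuous_snd)
        continuous_const)
  · rintro R ⟨hR1, hR2⟩
    rcases subsingleton_or_nontrivial X with hs | hn
    · apply subset_closure
      refine ⟨Homeomorph.refl X, ?_⟩
      ext ⟨x, y⟩
      obtain ⟨y', hy'⟩ := hR1 x
      rw [Subsingleton.elim y' y] at hy'
      simp only [mem_ofPred_eq]
      exact ⟨fun _ => Subsingleton.elim _ _, fun _ => hy'⟩
    · rw [Metric.mem_closure_iff]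
      intro ε hε
      obtain ⟨t, p, hp, hpd⟩ := hh_part hX (ε / 2) (half_pos hε)
      let G := {g : Set t × Set t // ∃ z ∈ (R : Set (X × X)), p z.1 = g.1 ∧ p z.2 = g.2}
      obtain ⟨a, ha, hap, has⟩ := hh_lift_s2 hX p hp (fun g : G => g.1.1)
        (fun x => by
          obtain ⟨y, hy⟩ := hR1 x
          exact ⟨⟨(p x, p y), (x, y), hy, rfl, rfl⟩, rfl⟩)
        (fun g => by
          obtain ⟨⟨i, j⟩, z, hz, h1, h2⟩ := g
          exact ⟨z.1, h1⟩)
      obtain ⟨b, hb, hbp, hbs⟩ := hh_lift_s2 hX p hp (fun g : G => g.1.2)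
        (fun y => by
          obtain ⟨x, hx⟩ := hR2 y
          exact ⟨⟨(p x, p y), (x, y), hx, rfl, rfl⟩, rfl⟩)
        (fun g => by
          obtain ⟨⟨i, j⟩, z, hz, h1, h2⟩ := g
          exact ⟨z.2, h2⟩)
      obtain ⟨f, hf⟩ := hh_glue a b ha (fun g => hX.2.2 _ _ (ha.isClopen_fiber g)
        (hb.isClopen_fiber g) (has g) (hbs g))
      have hcl : IsClosed {q : X × X | q.2 = f q.1} :=
        isClosed_eq continuous_snd (f.continuous.comp continuous_fst)
      refine ⟨⟨⟨{q : X × X | q.2 = f q.1}, hcl.isCompact⟩,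
        ⟨(Classical.arbitrary X, f (Classical.arbitrary X)), rfl⟩⟩, ⟨f, rfl⟩, ?_⟩
      rw [Metric.NonemptyCompacts.dist_eq]
      refine lt_of_le_of_lt (Metric.hausdorffDist_le_of_mem_dist (half_pos hε).le ?_ ?_)
        (half_lt_self hε)
      · rintro ⟨x, y⟩ hxy
        obtain ⟨w, hw⟩ := has ⟨(p x, p y), (x, y), hxy, rfl, rfl⟩
        refine ⟨(w, f w), rfl, ?_⟩
        have h1 := hap w
        have h2 := hbp (f w)
        rw [hf] at h2
        rw [hw] at h1 h2
        exact max_le (hpd _ _ h1).le (hpd _ _ h2).le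
      · rintro ⟨w, y⟩ hy
        have hy : y = f w := hy
        subst hy
        obtain ⟨z, hz, h1, h2⟩ := (a w).2
        refine ⟨z, hz, ?_⟩
        have h3 := hap w
        have h4 := hbp (f w)
        rw [hf] at h4
        exact max_le (hpd _ _ (h3.symm.trans h1.symm)).le (hpd _ _ (h4.symm.trans h2.symm)).le
end

section
/- Let X be an h-homogeneous compact Hausdorff space and G = Aut(X) with the compact-open topology. Then G is topologically simple: every closed normal subgroup of G equals either the trivial subgroup {id} or all of G. -/
open Set TopologicalSpace Filter

namespace HH
variable {X : Type*} [TopologicalSpace X]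

structure PH (U V : Set X) (f f' : X → X) : Prop where
  c : ContinuousOn f U
  c' : ContinuousOn f' V
  m : ∀ x ∈ U, f x ∈ V
  m' : ∀ x ∈ V, f' x ∈ U
  l : ∀ x ∈ U, f' (f x) = x
  r : ∀ x ∈ V, f (f' x) = x

theorem PH.symm {U V : Set X} {f f' : X → X} (h : PH U V f f') : PH V U f' f :=
  ⟨h.c', h.c, h.m', h.m, h.r, h.l⟩

theorem PH.refl (U : Set X) : PH U U id id :=
  ⟨continuousOn_id, continuousOn_id, fun _ h => h, fun _ h => h, fun _ _ => rfl, fun _ _ => rfl⟩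

theorem exists_PH (hX : IsHHomogeneous X) {U V : Set X} (hU : IsClopen U) (hV : IsClopen V)
    (hU' : U.Nonempty) (hV' : V.Nonempty) : ∃ f f', PH U V f f' := by
  classical
  obtain ⟨e⟩ := hX.2.2 U V hU hV hU' hV'
  refine ⟨fun x => if h : x ∈ U then e ⟨x, h⟩ else x,
    fun x => if h : x ∈ V then e.symm ⟨x, h⟩ else x, ?_, ?_, ?_, ?_, ?_, ?_⟩
  · rw [continuousOn_iff_continuous_domRestrict]
    have : (U.domRestrict fun x => if h : x ∈ U then ((e ⟨x, h⟩ : V) : X) else x)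
      = fun x => ((e x : V) : X) := by
      ext x; simp [Set.domRestrict]
    rw [this]; fun_prop
  · rw [continuousOn_iff_continuous_domRestrict]
    have : (V.domRestrict fun x => if h : x ∈ V then ((e.symm ⟨x, h⟩ : U) : X) else x)
      = fun x => ((e.symm x : U) : X) := by
      ext x; simp [Set.domRestrict]
    rw [this]; fun_prop
  · intro x hx; simp [hx]
  · intro x hx; simp [hx]
  · intro x hx; simp [hx]
  · intro x hx; simp [hx]

open Classical in
theorem cont3 {A B : Set X} (hA : IsClopen A) (hB : IsClopen B) {f g h : X → X}
    (hf : ContinuousOn f A) (hg : ContinuousOn g B) (hh : ContinuousOn h (A ∪ B)ᶜ) :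
    Continuous (fun x => if x ∈ A then f x else if x ∈ B then g x else h x) := by
  rw [continuous_iff_continuousAt]
  intro x
  by_cases hxA : x ∈ A
  · have hn := hA.isOpen.mem_nhds hxA
    refine (hf.continuousAt hn).congr ?_
    filter_upwards [hn] with y hy
    simp [hy]
  by_cases hxB : x ∈ B
  · have hn := hB.isOpen.mem_nhds hxB
    have hn2 := hA.compl.isOpen.mem_nhds hxA
    refine (hg.continuousAt hn).congr ?_
    filter_upwards [hn, hn2] with y hy hy2
    have : y ∉ A := hy2
    simp [hy, this]
  · have hn := (hA.union hB).compl.isOpen.mem_nhds (x := x) (by simp [hxA, hxB])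
    refine (hh.continuousAt hn).congr ?_
    filter_upwards [hn] with y hy
    have : y ∉ A ∧ y ∉ B := by simpa using hy
    simp [this]

theorem glue {A B A' B' : Set X} (hA : IsClopen A) (hB : IsClopen B) (hA' : IsClopen A')
    (hB' : IsClopen B') (hd : Disjoint A B) (hd' : Disjoint A' B')
    {f f' g g' h h' : X → X} (hf : PH A A' f f') (hg : PH B B' g g')
    (hh : PH (A ∪ B)ᶜ (A' ∪ B')ᶜ h h') :
    ∃ k : X ≃ₜ X, (∀ x ∈ A, k x = f x) ∧ (∀ x ∈ B, k x = g x) ∧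
      ∀ x, x ∉ A → x ∉ B → k x = h x := by
  classical
  have hd := Set.disjoint_left.1 hd
  have hd' := Set.disjoint_left.1 hd'
  have hm := hh.m
  have hm' := hh.m'
  have hl := hh.l
  have hr := hh.r
  simp only [mem_compl_iff, mem_union, not_or] at hm hm' hl hr
  refine ⟨⟨⟨fun x => if x ∈ A then f x else if x ∈ B then g x else h x,
    fun x => if x ∈ A' then f' x else if x ∈ B' then g' x else h' x, ?_, ?_⟩,
    cont3 hA hB hf.c hg.c hh.c, cont3 hA' hB' hf.c' hg.c' hh.c'⟩, ?_, ?_, ?_⟩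
  · intro x
    by_cases hxA : x ∈ A
    · simp [hxA, hf.m x hxA, hf.l x hxA]
    by_cases hxB : x ∈ B
    · have := hg.m x hxB
      have h2 : g x ∉ A' := fun h => hd' h this
      simp [hxA, hxB, this, h2, hg.l x hxB]
    · have := hm x ⟨hxA, hxB⟩
      simp [hxA, hxB, this, hl x ⟨hxA, hxB⟩]
  · intro x
    by_cases hxA : x ∈ A'
    · simp [hxA, hf.m' x hxA, hf.r x hxA]
    by_cases hxB : x ∈ B'
    · have := hg.m' x hxB
      have h2 : g' x ∉ A := fun h => hd h this
      simp [hxA, hxB, this, h2, hg.r x hxB]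
    · have := hm' x ⟨hxA, hxB⟩
      simp [hxA, hxB, this, hr x ⟨hxA, hxB⟩]
  · intro x hx
    change (if x ∈ A then f x else if x ∈ B then g x else h x) = _
    simp [hx]
  · intro x hx
    have : x ∉ A := fun h => hd h hx
    change (if x ∈ A then f x else if x ∈ B then g x else h x) = _
    simp [hx, this]
  · intro x hx hx'
    change (if x ∈ A then f x else if x ∈ B then g x else h x) = _
    simp [hx, hx']

structure IsSwap (s : X ≃ₜ X) (A B : Set X) : Prop where
  inv : ∀ x, s (s x) = x
  ab : ∀ x ∈ A, s x ∈ B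
  ba : ∀ x ∈ B, s x ∈ A
  fix : ∀ x, x ∉ A → x ∉ B → s x = x

theorem exists_swap (hX : IsHHomogeneous X) {A B : Set X} (hA : IsClopen A) (hB : IsClopen B)
    (hA' : A.Nonempty) (hB' : B.Nonempty) (hd : Disjoint A B) :
    ∃ s : X ≃ₜ X, IsSwap s A B := by
  obtain ⟨f, f', hf⟩ := exists_PH hX hA hB hA' hB'
  obtain ⟨k, k1, k2, k3⟩ := glue hA hB hB hA hd hd.symm hf hf.symm
    (by rw [Set.union_comm B A]; exact PH.refl _)
  have ab : ∀ x ∈ A, k x ∈ B := fun x hx => by rw [k1 x hx]; exact hf.m x hx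
  have ba : ∀ x ∈ B, k x ∈ A := fun x hx => by rw [k2 x hx]; exact hf.m' x hx
  refine ⟨k, fun x => ?_, ab, ba, k3⟩
  by_cases hxA : x ∈ A
  · rw [k2 _ (ab x hxA), k1 x hxA, hf.l x hxA]
  by_cases hxB : x ∈ B
  · rw [k1 _ (ba x hxB), k2 x hxB, hf.r x hxB]
  · rw [k3 x hxA hxB]; exact k3 x hxA hxB

theorem swap_conj (hX : IsHHomogeneous X) {A B A' B' : Set X} (hA : IsClopen A) (hB : IsClopen B)
    (hA' : IsClopen A') (hB' : IsClopen B') (hd : Disjoint A B) (hd' : Disjoint A' B')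
    (nA : A.Nonempty) (nA' : A'.Nonempty) (nC : (A ∪ B)ᶜ.Nonempty) (nC' : (A' ∪ B')ᶜ.Nonempty)
    {s s' : X ≃ₜ X} (hs : IsSwap s A B) (hs' : IsSwap s' A' B') :
    ∃ k : X ≃ₜ X, ∀ x, s' (k x) = k (s x) := by
  obtain ⟨f, f', hf⟩ := exists_PH hX hA hA' nA nA'
  obtain ⟨h, h', hh⟩ := exists_PH hX (hA.union hB).compl (hA'.union hB').compl nC nC'
  have hg : PH B B' (fun x => s' (f (s x))) (fun x => s (f' (s' x))) := by
    refine ⟨?_, ?_, ?_, ?_, ?_, ?_⟩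
    · exact s'.continuous.comp_continuousOn (hf.c.comp s.continuous.continuousOn hs.ba)
    · exact s.continuous.comp_continuousOn (hf.c'.comp s'.continuous.continuousOn hs'.ba)
    · exact fun x hx => hs'.ab _ (hf.m _ (hs.ba x hx))
    · exact fun x hx => hs.ab _ (hf.m' _ (hs'.ba x hx))
    · intro x hx
      simp only [hs'.inv]
      rw [hf.l _ (hs.ba x hx), hs.inv]
    · intro x hx
      simp only [hs.inv]
      rw [hf.r _ (hs'.ba x hx), hs'.inv]
  obtain ⟨k, k1, k2, k3⟩ := glue hA hB hA' hB' hd hd' hf hg hh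
  refine ⟨k, fun x => ?_⟩
  by_cases hxA : x ∈ A
  · rw [k1 x hxA, k2 _ (hs.ab x hxA), hs.inv]
  by_cases hxB : x ∈ B
  · rw [k2 x hxB, k1 _ (hs.ba x hxB), hs'.inv]
  · rw [hs.fix x hxA hxB, k3 x hxA hxB]
    have := hh.m x (by simp [hxA, hxB])
    simp only [mem_compl_iff, mem_union, not_or] at this
    exact hs'.fix _ this.1 this.2

theorem split (hX : IsHHomogeneous X) {V : Set X} (hV : IsClopen V) (n1 : V.Nonempty)
    (n2 : Vᶜ.Nonempty) {U : Set X} (hU : IsClopen U) (nU : U.Nonempty) :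
    ∃ R, IsClopen R ∧ R ⊆ U ∧ R.Nonempty ∧ (U \ R).Nonempty := by
  obtain ⟨f, f', hf⟩ := exists_PH hX isClopen_univ hU (n1.mono (subset_univ _)) nU
  have key : ∀ W : Set X, IsClopen W → IsClopen (U ∩ f' ⁻¹' W) := fun W hW =>
    ⟨hf.c'.preimage_isClosed_of_isClosed hU.isClosed hW.isClosed,
      hf.c'.isOpen_inter_preimage hU.isOpen hW.isOpen⟩
  refine ⟨U ∩ f' ⁻¹' V, key V hV, inter_subset_left, ?_, ?_⟩
  · obtain ⟨x, hx⟩ := n1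
    exact ⟨f x, hf.m x trivial, by simpa [hf.l x trivial] using hx⟩
  · obtain ⟨x, hx⟩ := n2
    refine ⟨f x, hf.m x trivial, ?_⟩
    simpa [hf.l x trivial, hf.m x trivial] using hx

/-- All swaps with nonempty rest are in `N`. -/
theorem swaps_mem [T2Space X] (hX : IsHHomogeneous X) (N : Subgroup (X ≃ₜ X)) (hN : N.Normal)
    (hne : N ≠ ⊥) :
    (∃ V : Set X, IsClopen V ∧ V.Nonempty ∧ Vᶜ.Nonempty) ∧
    ∀ (A B : Set X), IsClopen A → IsClopen B → Disjoint A B → A.Nonempty → (A ∪ B)ᶜ.Nonempty →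
      ∀ s : X ≃ₜ X, IsSwap s A B → s ∈ N := by
  obtain ⟨h, hhN, hh1⟩ : ∃ h ∈ N, h ≠ 1 := by
    by_contra! hc
    exact hne ((Subgroup.eq_bot_iff_forall N).2 hc)
  obtain ⟨x, hx⟩ : ∃ x, h x ≠ x := by
    by_contra! hc
    exact hh1 (Homeomorph.ext hc)
  obtain ⟨V, hV, hxV, hVs⟩ := hX.2.1.exists_subset_of_mem_open (a := x) (u := {h x}ᶜ)
    (by simpa using hx.symm) isOpen_compl_singleton
  have hhxV : h x ∉ V := fun hc => hVs hc rfl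
  have hV : IsClopen V := hV
  refine ⟨⟨V, hV, ⟨x, hxV⟩, ⟨h x, hhxV⟩⟩, ?_⟩
  have spl := fun {U : Set X} => split hX hV ⟨x, hxV⟩ ⟨h x, hhxV⟩ (U := U)
  set U := V \ h ⁻¹' V with hUdef
  have hU : IsClopen U := hV.diff (hV.preimage h.continuous)
  have nU : U.Nonempty := ⟨x, hxV, hhxV⟩
  have hUd : ∀ y ∈ U, h y ∉ U := fun y hy hy' => hy.2 hy'.1
  have hUd' : ∀ y ∈ U, h.symm y ∉ U := fun y hy hy' => hUd _ hy' (by simpa using hy)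
  obtain ⟨U1, c1, s1, n1, d1⟩ := spl hU nU
  obtain ⟨U2, c2, s2, n2, d2⟩ := spl (hU.diff c1) d1
  have s2' : U2 ⊆ U := fun y hy => (s2 hy).1
  have hd12 : Disjoint U1 U2 := Set.disjoint_left.2 fun y hy hy' => (s2 hy').2 hy
  obtain ⟨t, ht⟩ := exists_swap hX c1 c2 n1 n2 hd12
  have tfix : ∀ y, y ∉ U → t y = y := fun y hy => ht.fix y (fun h => hy (s1 h)) (fun h => hy (s2' h))
  have tU : ∀ y ∈ U, t y ∈ U := fun y hy => by
    by_contra hc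
    have := tfix _ hc
    rw [ht.inv] at this
    exact hc (this ▸ hy)
  have htt : t⁻¹ = t := by
    refine Homeomorph.ext fun y => ?_
    change t.symm y = t y
    rw [Homeomorph.symm_apply_eq, ht.inv]
  have hn : t * h * t⁻¹ * h⁻¹ ∈ N := N.mul_mem (hN.conj_mem _ hhN _) (N.inv_mem hhN)
  rw [htt] at hn
  set n := t * h * t * h⁻¹ with hndef
  have nap : ∀ y, n y = t (h (t (h.symm y))) := fun y => rfl
  have nU1 : ∀ y ∈ U, n y = t y := fun y hy => by
    rw [nap, tfix _ (hUd' y hy), h.apply_symm_apply]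
  have nU2 : ∀ y, h.symm y ∈ U → n y = h (t (h.symm y)) := fun y hy => by
    rw [nap]; exact tfix _ (hUd _ (tU _ hy))
  have hns : IsSwap n (U1 ∪ h.symm ⁻¹' U1) (U2 ∪ h.symm ⁻¹' U2) := by
    refine ⟨fun y => ?_, ?_, ?_, ?_⟩
    · by_cases h1 : y ∈ U
      · rw [nU1 y h1, nU1 _ (tU y h1), ht.inv]
      by_cases h2 : h.symm y ∈ U
      · rw [nU2 y h2, nU2 _ (by simpa using tU _ h2)]
        simp [ht.inv]
      · have : n y = y := by rw [nap, tfix _ h2, h.apply_symm_apply, tfix _ h1]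
        rw [this, this]
    · rintro y (hy | hy)
      · rw [nU1 y (s1 hy)]; exact Or.inl (ht.ab y hy)
      · rw [nU2 y (s1 hy)]; exact Or.inr (by simpa using ht.ab _ hy)
    · rintro y (hy | hy)
      · rw [nU1 y (s2' hy)]; exact Or.inl (ht.ba y hy)
      · rw [nU2 y (s2' hy)]; exact Or.inr (by simpa using ht.ba _ hy)
    · intro y h1 h2
      simp only [mem_union, mem_preimage, not_or] at h1 h2
      rw [nap, ht.fix _ h1.2 h2.2, h.apply_symm_apply, ht.fix _ h1.1 h2.1]
  intro A B hA hB hd nA nC s hs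
  have D1 : Disjoint (U1 ∪ h.symm ⁻¹' U1) (U2 ∪ h.symm ⁻¹' U2) := by
    rw [Set.disjoint_left] at hd12 ⊢
    rintro y (h1 | h1) (h2 | h2)
    · exact hd12 h1 h2
    · exact hUd' y (s1 h1) (s2' h2)
    · exact hUd' y (s2' h2) (s1 h1)
    · exact hd12 h1 h2
  have D2 : ((U1 ∪ h.symm ⁻¹' U1) ∪ (U2 ∪ h.symm ⁻¹' U2))ᶜ.Nonempty := by
    obtain ⟨z, ⟨hz, hz1⟩, hz2⟩ := d2
    refine ⟨z, ?_⟩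
    simp only [mem_compl_iff, mem_union, mem_preimage, not_or]
    exact ⟨⟨hz1, fun h => hUd' z hz (s1 h)⟩, hz2, fun h => hUd' z hz (s2' h)⟩
  obtain ⟨k, hk⟩ := swap_conj hX hA hB (c1.union (c1.preimage h.symm.continuous))
    (c2.union (c2.preimage h.symm.continuous)) hd D1 nA (n1.mono subset_union_left) nC D2 hs hns
  have : s = k⁻¹ * n * k⁻¹⁻¹ := by
    refine Homeomorph.ext fun y => ?_
    change s y = k.symm (n (k y))
    rw [hk, k.symm_apply_apply]
  rw [this]
  exact hN.conj_mem _ hn _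

/-- `Q` can be moved to `P` inside `Y` by an element of `N`. -/
def Mov (N : Subgroup (X ≃ₜ X)) (Y Q P : Set X) : Prop :=
  ∃ p ∈ N, (∀ y, y ∉ Y → p y = y) ∧ ∀ y, p y ∈ P ↔ y ∈ Q

theorem Mov.trans {N : Subgroup (X ≃ₜ X)} {Y Q R P : Set X} (h1 : Mov N Y Q R)
    (h2 : Mov N Y R P) : Mov N Y Q P := by
  obtain ⟨p, hp, p1, p2⟩ := h1
  obtain ⟨q, hq, q1, q2⟩ := h2
  refine ⟨q * p, N.mul_mem hq hp, fun y hy => ?_, fun y => ?_⟩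
  · change q (p y) = y
    rw [p1 y hy, q1 y hy]
  · change q (p y) ∈ P ↔ _
    rw [q2, p2]

theorem mov_disj (hX : IsHHomogeneous X) {N : Subgroup (X ≃ₜ X)}
    (H : ∀ (A B : Set X), IsClopen A → IsClopen B → Disjoint A B → A.Nonempty →
      (A ∪ B)ᶜ.Nonempty → ∀ s : X ≃ₜ X, IsSwap s A B → s ∈ N) {Y Q P : Set X}
    (hQ : IsClopen Q) (hP : IsClopen P) (nQ : Q.Nonempty) (nP : P.Nonempty)
    (hd : Disjoint Q P) (hQY : Q ⊆ Y) (hPY : P ⊆ Y) (nC : (Q ∪ P)ᶜ.Nonempty) : Mov N Y Q P := by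
  obtain ⟨s, hs⟩ := exists_swap hX hQ hP nQ nP hd
  refine ⟨s, H Q P hQ hP hd nQ nC s hs, fun y hy => hs.fix y (fun h => hy (hQY h))
    (fun h => hy (hPY h)), fun y => ⟨fun h => ?_, hs.ab y⟩⟩
  have := hs.ba _ h
  rwa [hs.inv] at this

theorem mov_good (hX : IsHHomogeneous X) {N : Subgroup (X ≃ₜ X)}
    (hV : ∃ V : Set X, IsClopen V ∧ V.Nonempty ∧ Vᶜ.Nonempty)
    (H : ∀ (A B : Set X), IsClopen A → IsClopen B → Disjoint A B → A.Nonempty →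
      (A ∪ B)ᶜ.Nonempty → ∀ s : X ≃ₜ X, IsSwap s A B → s ∈ N) {Y Q P : Set X}
    (hY : IsClopen Y)
    (hQ : IsClopen Q) (hP : IsClopen P) (nQ : Q.Nonempty) (nP : P.Nonempty)
    (hQY : Q ⊆ Y) (hPY : P ⊆ Y) (nC : (Y \ (Q ∪ P)).Nonempty) : Mov N Y Q P := by
  obtain ⟨V, hV, V1, V2⟩ := hV
  obtain ⟨R, cR, sR, nR, z, ⟨hzY, hzQP⟩, hzR⟩ := split hX hV V1 V2 (hY.diff (hQ.union hP)) nC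
  have hRY : R ⊆ Y := fun y hy => (sR hy).1
  simp only [mem_union, not_or] at hzQP
  have a : Mov N Y Q R := by
    refine mov_disj hX H hQ cR nQ nR ?_ hQY hRY ⟨z, by simp [hzQP, hzR]⟩
    exact Set.disjoint_left.2 fun y h1 h2 => (sR h2).2 (Or.inl h1)
  have b : Mov N Y R P := by
    refine mov_disj hX H cR hP nR nP ?_ hRY hPY ⟨z, by simp [hzQP, hzR]⟩
    exact Set.disjoint_left.2 fun y h1 h2 => (sR h1).2 (Or.inr h2)
  exact a.trans b

theorem mov_gen (hX : IsHHomogeneous X) {N : Subgroup (X ≃ₜ X)}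
    (hV : ∃ V : Set X, IsClopen V ∧ V.Nonempty ∧ Vᶜ.Nonempty)
    (H : ∀ (A B : Set X), IsClopen A → IsClopen B → Disjoint A B → A.Nonempty →
      (A ∪ B)ᶜ.Nonempty → ∀ s : X ≃ₜ X, IsSwap s A B → s ∈ N) {Y Q P : Set X}
    (hY : IsClopen Y)
    (hQ : IsClopen Q) (hP : IsClopen P) (nQ : Q.Nonempty) (nP : P.Nonempty)
    (hQY : Q ⊆ Y) (hPY : P ⊆ Y) (cQ : (Y \ Q).Nonempty) (cP : (Y \ P).Nonempty) :
    Mov N Y Q P := by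
  by_cases hc : (Y \ (Q ∪ P)).Nonempty
  · exact mov_good hX hV H hY hQ hP nQ nP hQY hPY hc
  have hc' : ∀ y ∈ Y, y ∉ P → y ∈ Q := fun y hy hyP => by
    by_contra hyQ
    exact hc ⟨y, hy, by simp [hyP, hyQ]⟩
  obtain ⟨V, cV, V1, V2⟩ := id hV
  obtain ⟨R, cR, sR, nR, z, ⟨hzY, hzP⟩, hzR⟩ := split hX cV V1 V2 (hY.diff hP) cP
  have hRY : R ⊆ Y := fun y hy => (sR hy).1
  have hRQ : R ⊆ Q := fun y hy => hc' y (sR hy).1 (sR hy).2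
  have a : Mov N Y Q R := mov_good hX hV H hY hQ cR nQ nR hQY hRY
    (by rwa [Set.union_eq_self_of_subset_right hRQ])
  have b : Mov N Y R P := mov_good hX hV H hY cR hP nR nP hRY hPY
    ⟨z, hzY, by simp [hzR, hzP]⟩
  exact a.trans b

theorem colours (hX : IsHHomogeneous X) {N : Subgroup (X ≃ₜ X)}
    (hV : ∃ V : Set X, IsClopen V ∧ V.Nonempty ∧ Vᶜ.Nonempty)
    (H : ∀ (A B : Set X), IsClopen A → IsClopen B → Disjoint A B → A.Nonempty →
      (A ∪ B)ᶜ.Nonempty → ∀ s : X ≃ₜ X, IsSwap s A B → s ∈ N)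
    {ι : Type*} (c : X → ι) (hc : ∀ S : Set ι, IsClopen (c ⁻¹' S))
    (g : X ≃ₜ X) (S : Finset ι) :
    ∃ n ∈ N, ∀ x, ∀ i ∈ S, c (n x) = i ↔ c (g x) = i := by
  classical
  induction S using Finset.induction_on with
  | empty => exact ⟨1, N.one_mem, by simp⟩
  | insert a S haS ih =>
    obtain ⟨n, hn, hnS⟩ := ih
    set g' : X ≃ₜ X := g * n⁻¹ with hg'
    have hgn : ∀ x, g' (n x) = g x := fun x => congrArg g (n.symm_apply_apply x)
    have h1 : ∀ y, ∀ i ∈ S, c y = i ↔ c (g' y) = i := fun y i hi => by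
      have := hnS (n.symm y) i hi
      rw [← hgn] at this
      simpa using this
    have h1' : ∀ y, c y ∈ S ↔ c (g' y) ∈ S := fun y =>
      ⟨fun h => by rw [(h1 y _ h).1 rfl]; exact h, fun h => by rw [(h1 y _ h).2 rfl]; exact h⟩
    set Y : Set X := c ⁻¹' {i | i ∉ S} with hYd
    set P : Set X := c ⁻¹' {a} with hPd
    set Q : Set X := g' ⁻¹' P with hQd
    have hPY : P ⊆ Y := fun y hy => by
      have : c y = a := hy
      change c y ∉ S
      rwa [this]
    have hgY : ∀ y, g' y ∈ Y ↔ y ∈ Y := fun y => (h1' y).symm.not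
    have hQY : Q ⊆ Y := fun y hy => (hgY y).1 (hPY hy)
    have key : Mov N Y Q P := by
      have one (h : Q = P) : Mov N Y Q P := ⟨1, N.one_mem, fun _ _ => rfl, fun y => by rw [h]; rfl⟩
      by_cases nP : P.Nonempty
      · by_cases cP : (Y \ P).Nonempty
        · refine mov_gen hX hV H (hc _) ((hc _).preimage g'.continuous) (hc _) ?_ nP hQY hPY ?_ cP
          · obtain ⟨y, hy⟩ := nP
            exact ⟨g'.symm y, by simpa [hQd] using hy⟩
          · obtain ⟨y, hy, hyP⟩ := cP
            refine ⟨g'.symm y, (hgY _).1 (by simpa using hy), ?_⟩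
            simpa [hQd] using hyP
        · have : P = Y := hPY.antisymm (Set.sdiff_eq_empty.1 (Set.not_nonempty_iff_eq_empty.1 cP))
          apply one
          ext y
          change g' y ∈ P ↔ _
          rw [this, hgY]
      · apply one
        rw [Set.not_nonempty_iff_eq_empty] at nP
        rw [hQd, nP]; rfl
    obtain ⟨p, hp, p1, p2⟩ := key
    refine ⟨p * n, N.mul_mem hp hn, fun x i hi => ?_⟩
    change c (p (n x)) = i ↔ _
    rw [← hgn]
    generalize n x = y
    rcases Finset.mem_insert.1 hi with rfl | hi
    · exact p2 y
    · by_cases hy : y ∈ Y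
      · have hpy : p y ∈ Y := by
          by_contra hc
          have := p1 _ hc
          rw [p.injective this] at hc
          exact hc hy
        have hgy := (hgY y).2 hy
        constructor
        · rintro rfl; exact absurd hi hpy
        · rintro rfl; exact absurd hi hgy
      · rw [p1 y hy]; exact h1 y i hi

theorem nhd [CompactSpace X] [T2Space X] (hX : IsHHomogeneous X) (g : X ≃ₜ X)
    (W : Set (X ≃ₜ X)) (hW : IsOpen W) (hg : g ∈ W) :
    ∃ F : Set (Set X), F.Finite ∧ (∀ V ∈ F, IsClopen V) ∧
      ∀ f : X ≃ₜ X, (∀ V ∈ F, ∀ x, f x ∈ V ↔ g x ∈ V) → f ∈ W := by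
  obtain ⟨W', hW', rfl⟩ := isOpen_induced_iff.1 hW
  change TopologicalSpace.GenerateOpen _ W' at hW'
  clear hW
  induction hW' with
  | basic s hs =>
    obtain ⟨K, hK, U, hU, rfl⟩ := hs
    have hgK : IsCompact (g '' K) := hK.image g.continuous
    have hsub : g '' K ⊆ U := Set.image_subset_iff.2 hg
    obtain ⟨V, hV, h1, h2⟩ : ∃ V, IsClopen V ∧ g '' K ⊆ V ∧ V ⊆ U := by
      refine hgK.induction_on (p := fun s => ∃ V, IsClopen V ∧ s ⊆ V ∧ V ⊆ U) ?_ ?_ ?_ ?_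
      · exact ⟨∅, isClopen_empty, by simp, by simp⟩
      · rintro s t hst ⟨V, a, b, c⟩
        exact ⟨V, a, hst.trans b, c⟩
      · rintro s t ⟨V, a, b, c⟩ ⟨V', a', b', c'⟩
        exact ⟨V ∪ V', a.union a', union_subset_union b b', union_subset c c'⟩
      · intro x hx
        obtain ⟨V, hV, hxV, hVs⟩ := hX.2.1.exists_subset_of_mem_open (hsub hx) hU
        exact ⟨V, mem_nhdsWithin_of_mem_nhds ((show IsClopen V from hV).isOpen.mem_nhds hxV), V, hV, Subset.rfl, hVs⟩
    refine ⟨{V}, Set.finite_singleton _, by simpa using hV, fun f hf x hx => h2 ?_⟩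
    exact (hf V rfl x).2 (h1 ⟨x, hx, rfl⟩)
  | univ => exact ⟨∅, Set.finite_empty, by simp, fun _ _ => trivial⟩
  | inter s t _ _ ihs iht =>
    obtain ⟨F, a, b, c⟩ := ihs hg.1
    obtain ⟨F', a', b', c'⟩ := iht hg.2
    refine ⟨F ∪ F', a.union a', ?_, fun f hf => ⟨c f fun V hV => hf V (Or.inl hV),
      c' f fun V hV => hf V (Or.inr hV)⟩⟩
    rintro V (h | h)
    exacts [b V h, b' V h]
  | sUnion S _ ih =>
    obtain ⟨s, hs, hgs⟩ := hg
    obtain ⟨F, a, b, c⟩ := ih s hs hgs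
    exact ⟨F, a, b, fun f hf => ⟨s, hs, c f hf⟩⟩

end HH

/-- The group of self-homeomorphisms of an h-homogeneous compact Hausdorff space is
topologically simple: every closed normal subgroup is trivial or everything. -/
theorem topologically_simple_of_isHHomogeneous
    {X : Type*} [TopologicalSpace X] [CompactSpace X] [T2Space X]
    (hX : IsHHomogeneous X)
    (N : Subgroup (X ≃ₜ X)) (hN : N.Normal) (hNc : IsClosed (N : Set (X ≃ₜ X))) :
    N = ⊥ ∨ N = ⊤ := by
  by_cases hne : N = ⊥
  · exact Or.inl hne
  right
  obtain ⟨hV, H⟩ := HH.swaps_mem hX N hN hne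
  rw [eq_top_iff]
  intro g _
  change g ∈ (N : Set (X ≃ₜ X))
  rw [← hNc.closure_eq, mem_closure_iff]
  intro W hW hg
  obtain ⟨F, hF, hFc, hFW⟩ := HH.nhd hX g W hW hg
  have : Finite F := hF
  let c : X → Set F := fun x => {V | x ∈ V.1}
  have : Fintype (Set F) := Fintype.ofFinite _
  have hc1 : ∀ T : Set F, IsClopen (c ⁻¹' {T}) := fun T => by
    have : c ⁻¹' {T} = ⋂ V : F, {x | x ∈ V.1 ↔ V ∈ T} := by
      ext x
      simp only [mem_preimage, mem_singleton_iff, mem_iInter, mem_ofPred_eq, c, Set.ext_iff]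
    rw [this]
    refine isClopen_iInter_of_finite fun V => ?_
    by_cases h : V ∈ T
    · simpa [h] using hFc V.1 V.2
    · have e : {x | x ∈ V.1 ↔ V ∈ T} = V.1ᶜ := by ext x; simp [h]
      rw [e]; exact (hFc V.1 V.2).compl
  have hc : ∀ S : Set (Set F), IsClopen (c ⁻¹' S) := fun S => by
    have : c ⁻¹' S = ⋃ T ∈ S, c ⁻¹' {T} := by ext; simp
    rw [this]
    exact (Set.toFinite S).isClopen_biUnion fun T _ => hc1 T
  obtain ⟨n, hn, hnc⟩ := HH.colours hX hV H c hc g Finset.univ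
  refine ⟨n, hFW n fun V hV x => ?_, hn⟩
  have := (hnc x _ (Finset.mem_univ _)).2 rfl
  exact Set.ext_iff.1 this ⟨V, hV⟩
end

section
/- Let K be a compact Hausdorff space, let R, S ⊆ K × K be closed relations, and let O be an open subset of K × K with RS ⊆ O. Then there exist open sets V₁, V₂ ⊆ K × K with R ⊆ V₁ and S ⊆ V₂ such that for every pair of closed relations R', S' on K with R' ⊆ V₁ and S' ⊆ V₂ one has R'S' ⊆ O. -/
open Set

/-- Upper semicontinuity of composition of closed relations on a compact Hausdorff space:
if `RS ⊆ O` with `O` open, then there are open `V₁ ⊇ R` and `V₂ ⊇ S` such that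
`R'S' ⊆ O` whenever `R', S'` are closed relations with `R' ⊆ V₁` and `S' ⊆ V₂`. -/
theorem relComp_upper_semicontinuous
    {K : Type*} [TopologicalSpace K] [CompactSpace K] [T2Space K]
    (R S : Set (K × K)) (hR : IsClosed R) (hS : IsClosed S)
    (O : Set (K × K)) (hO : IsOpen O) (hRS : relComp R S ⊆ O) :
    ∃ V₁ V₂ : Set (K × K), IsOpen V₁ ∧ IsOpen V₂ ∧ R ⊆ V₁ ∧ S ⊆ V₂ ∧
      ∀ R' S' : Set (K × K), IsClosed R' → IsClosed S' → R' ⊆ V₁ → S' ⊆ V₂ →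
        relComp R' S' ⊆ O := by
  have hW : IsOpen {q : (K × K) × (K × K) | q.1.1 ≠ q.2.2 ∨ (q.2.1, q.1.2) ∈ O} := by
    refine IsOpen.union (isOpen_ne_fun (by fun_prop) (by fun_prop)) ?_
    exact hO.preimage (f := fun q : (K × K) × (K × K) => (q.2.1, q.1.2)) (by fun_prop)
  obtain ⟨V₁, V₂, h1, h2, hR1, hS2, h⟩ := generalized_tube_lemma hR.isCompact hS.isCompact hW (by
    rintro ⟨⟨z, y⟩, ⟨x, z'⟩⟩ ⟨hr, hs⟩
    by_cases hz : z = z'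
    · subst hz
      exact Or.inr (hRS ⟨z, hs, hr⟩)
    · exact Or.inl hz)
  refine ⟨V₁, V₂, h1, h2, hR1, hS2, ?_⟩
  rintro R' S' - - hR' hS' ⟨x, y⟩ ⟨z, hs, hr⟩
  have := @h ((z, y), (x, z)) ⟨hR' hr, hS' hs⟩
  rcases this with h | h
  · exact absurd rfl h
  · exact h
end

section
/- Let X be a compact metric space and let Θ = E₀(X) be the set of closed relations R on X with Dom R = Ran R = X. Let S ⊆ Θ be closed under composition of relations and closed as a subset of the space of nonempty compact subsets of X × X with the Hausdorff metric. Let T = {p ∈ S : Δ ⊆ p}, where Δ = {(x,x) : x ∈ X} is the diagonal. If T is nonempty, then T has a greatest element p with respect to inclusion (i.e. q ⊆ p for all q ∈ T), and p is idempotent: pp = p. -/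
open Set TopologicalSpace

/-- Let `X` be a compact metric space and `S ⊆ E₀(X)` a subset that is closed in the
Hausdorff metric and closed under composition of relations. If the set
`T = {p ∈ S : Δ ⊆ p}` is nonempty, then `T` has a greatest element `p` (with respect to
inclusion) and `p` is idempotent: `pp = p`. -/
theorem greatest_idempotent_of_closed_subsemigroup
    {X : Type*} [MetricSpace X] [CompactSpace X]
    (S : Set (NonemptyCompacts (X × X))) (hS : S ⊆ E0 X) (hSclosed : IsClosed S)
    (hScomp : ∀ p ∈ S, ∀ q ∈ S, ∃ t ∈ S,
      (t : Set (X × X)) = relComp (p : Set (X × X)) (q : Set (X × X)))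
    (hT : ∃ q ∈ S, Set.diagonal X ⊆ (q : Set (X × X))) :
    ∃ p ∈ S, Set.diagonal X ⊆ (p : Set (X × X)) ∧
      (∀ q ∈ S, Set.diagonal X ⊆ (q : Set (X × X)) → (q : Set (X × X)) ⊆ (p : Set (X × X))) ∧
      relComp (p : Set (X × X)) (p : Set (X × X)) = (p : Set (X × X)) := by
  have hcl : ∀ x : X × X, IsClosed {p : NonemptyCompacts (X × X) | x ∈ (p : Set (X × X))} := by
    intro x
    have h : Continuous fun p : NonemptyCompacts (X × X) => Metric.infDist x (p : Set (X × X)) :=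
      (Metric.lipschitz_infDist_set x).continuous
    have h2 := isClosed_singleton (x := (0 : ℝ)) |>.preimage h
    convert h2 using 1
    ext p
    exact p.isCompact.isClosed.mem_iff_infDist_zero p.nonempty
  have hcl2 : ∀ A : Set (X × X),
      IsClosed {p : NonemptyCompacts (X × X) | A ⊆ (p : Set (X × X))} := by
    intro A
    have : {p : NonemptyCompacts (X × X) | A ⊆ (p : Set (X × X))}
        = ⋂ x ∈ A, {p : NonemptyCompacts (X × X) | x ∈ (p : Set (X × X))} := by
      ext p
      simp only [mem_setOf_eq, mem_iInter]
      rfl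
    rw [this]
    exact isClosed_biInter fun x _ => hcl x
  have hle : ∀ p q : Set (X × X), Set.diagonal X ⊆ p → Set.diagonal X ⊆ q →
      p ⊆ relComp p q ∧ q ⊆ relComp p q := by
    intro p q hp hq
    exact ⟨fun a ha => ⟨a.1, hq rfl, ha⟩, fun a ha => ⟨a.2, ha, hp rfl⟩⟩
  let T : Set (NonemptyCompacts (X × X)) := {q | q ∈ S ∧ Set.diagonal X ⊆ (q : Set (X × X))}
  have hTc : IsClosed T := hSclosed.inter (hcl2 _)
  haveI : Nonempty T := let ⟨q, h1, h2⟩ := hT; ⟨⟨q, h1, h2⟩⟩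
  let F : T → Set (NonemptyCompacts (X × X)) :=
    fun q => T ∩ {p | ((q : NonemptyCompacts (X × X)) : Set (X × X)) ⊆ (p : Set (X × X))}
  have hF : ∀ q, IsClosed (F q) := fun q => hTc.inter (hcl2 _)
  obtain ⟨p, hp⟩ : (⋂ q, F q).Nonempty := by
    apply IsCompact.nonempty_iInter_of_directed_nonempty_isCompact_isClosed
    · intro q r
      obtain ⟨t, htS, ht⟩ := hScomp q q.2.1 r r.2.1
      obtain ⟨h1, h2⟩ := hle _ _ q.2.2 r.2.2
      rw [← ht] at h1 h2
      exact ⟨⟨t, htS, q.2.2.trans h1⟩, fun a ha => ⟨ha.1, h1.trans ha.2⟩,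
        fun a ha => ⟨ha.1, h2.trans ha.2⟩⟩
    · exact fun q => ⟨q, q.2, Subset.rfl⟩
    · exact fun q => (hF q).isCompact
    · exact hF
  rw [mem_iInter] at hp
  have hpT : p ∈ T := (hp (Classical.arbitrary _)).1
  have hmax : ∀ q ∈ S, Set.diagonal X ⊆ (q : Set (X × X)) →
      (q : Set (X × X)) ⊆ (p : Set (X × X)) := fun q h1 h2 => (hp ⟨q, h1, h2⟩).2
  refine ⟨p, hpT.1, hpT.2, hmax, ?_⟩
  obtain ⟨t, htS, ht⟩ := hScomp p hpT.1 p hpT.1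
  have h1 := (hle _ _ hpT.2 hpT.2).1
  refine Subset.antisymm ?_ h1
  rw [← ht] at h1 ⊢
  exact hmax t htS (hpT.2.trans h1)
end

section
/- Let X be an h-homogeneous compact Hausdorff space and let R be a closed relation on X with Dom R = Ran R = X. Then R is invariant under all inner automorphisms, i.e. (f(x), f(y)) ∈ R for every (x,y) ∈ R and every self-homeomorphism f of X, if and only if R = Δ or R = X × X, where Δ = {(x,x) : x ∈ X} is the diagonal. In particular, if X has at least two points, then Δ and X × X are precisely the two elements of E₀(X) invariant under all inner automorphisms. -/
open Set TopologicalSpace Filter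

open Classical in
noncomputable def swapFun {X : Type*} [TopologicalSpace X] {U V : Set X} (e : U ≃ₜ V) (x : X) : X :=
  if h : x ∈ U then (e ⟨x, h⟩ : X) else if h : x ∈ V then (e.symm ⟨x, h⟩ : X) else x

lemma swapFun_U {X : Type*} [TopologicalSpace X] {U V : Set X} (e : U ≃ₜ V) {x : X} (h : x ∈ U) :
    swapFun e x = e ⟨x, h⟩ := by simp [swapFun, h]

lemma swapFun_V {X : Type*} [TopologicalSpace X] {U V : Set X} (e : U ≃ₜ V)
    (hd : Disjoint U V) {x : X} (h : x ∈ V) :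
    swapFun e x = e.symm ⟨x, h⟩ := by
  have : x ∉ U := fun h' => Set.disjoint_left.1 hd h' h
  simp [swapFun, h, this]

lemma swapFun_not {X : Type*} [TopologicalSpace X] {U V : Set X} (e : U ≃ₜ V)
    {x : X} (h : x ∉ U) (h' : x ∉ V) : swapFun e x = x := by
  simp [swapFun, h, h']

lemma swapFun_inv {X : Type*} [TopologicalSpace X] {U V : Set X} (e : U ≃ₜ V)
    (hd : Disjoint U V) (x : X) : swapFun e (swapFun e x) = x := by
  by_cases h : x ∈ U
  · rw [swapFun_U e h, swapFun_V e hd (e ⟨x, h⟩).2]; simp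
  by_cases h' : x ∈ V
  · rw [swapFun_V e hd h', swapFun_U e (e.symm ⟨x, h'⟩).2]; simp
  · rw [swapFun_not e h h', swapFun_not e h h']

lemma swapFun_cont {X : Type*} [TopologicalSpace X] {U V : Set X} (e : U ≃ₜ V)
    (hd : Disjoint U V) (hU : IsClopen U) (hV : IsClopen V) : Continuous (swapFun e) := by
  have h1 : ContinuousOn (swapFun e) U := by
    rw [continuousOn_iff_continuous_domRestrict]
    have : U.domRestrict (swapFun e) = fun x => (e x : X) := by
      ext x; exact swapFun_U e x.2
    rw [this]; fun_prop
  have h2 : ContinuousOn (swapFun e) V := by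
    rw [continuousOn_iff_continuous_domRestrict]
    have : V.domRestrict (swapFun e) = fun x => (e.symm x : X) := by
      ext x; exact swapFun_V e hd x.2
    rw [this]; fun_prop
  have h3 : ContinuousOn (swapFun e) (U ∪ V)ᶜ := by
    refine continuousOn_id.congr fun x hx => ?_
    simp only [mem_compl_iff, mem_union, not_or] at hx
    exact swapFun_not e hx.1 hx.2
  rw [continuous_iff_continuousAt]
  intro x
  by_cases h : x ∈ U
  · exact h1.continuousAt (hU.isOpen.mem_nhds h)
  by_cases h' : x ∈ V
  · exact h2.continuousAt (hV.isOpen.mem_nhds h')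
  · exact h3.continuousAt ((hU.union hV).compl.isOpen.mem_nhds (by simp [h, h']))

lemma exists_move {X : Type*} [TopologicalSpace X] [T2Space X]
    (hX : IsHHomogeneous X) {a b : X} (hab : a ≠ b) {V : Set X} (hV : IsClopen V)
    (hne : V.Nonempty) : ∃ f : X ≃ₜ X, f b ∈ V ∧ (a ∉ V → f a = a) := by
  by_cases hb : b ∈ V
  · exact ⟨Homeomorph.refl X, hb, fun _ => rfl⟩
  obtain ⟨N, hN, hbN, hsub⟩ := hX.2.1.exists_subset_of_mem_open
    (u := Vᶜ ∩ {a}ᶜ) (a := b) ⟨hb, fun h => hab h.symm⟩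
    (hV.compl.isOpen.inter isOpen_compl_singleton)
  obtain ⟨e⟩ := hX.2.2 N V hN hV ⟨b, hbN⟩ hne
  have hd : Disjoint N V := Set.disjoint_left.2 fun x hx => (hsub hx).1
  refine ⟨⟨⟨swapFun e, swapFun e, swapFun_inv e hd, swapFun_inv e hd⟩,
    swapFun_cont e hd hN hV, swapFun_cont e hd hN hV⟩, ?_, fun ha => ?_⟩
  · change swapFun e b ∈ V
    rw [swapFun_U e hbN]; exact (e _).2
  · exact swapFun_not e (fun h => (hsub h).2 rfl) ha

/-- Let `X` be an h-homogeneous compact Hausdorff space and `R` a closed relation on `X`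
with full domain and range. Then `R` is invariant under all inner automorphisms
(i.e. `(f x, f y) ∈ R` whenever `(x, y) ∈ R` and `f` is a self-homeomorphism of `X`)
if and only if `R` is the diagonal or all of `X × X`. -/
theorem invariant_closed_relation_iff
    {X : Type*} [TopologicalSpace X] [CompactSpace X] [T2Space X]
    (hX : IsHHomogeneous X)
    (R : Set (X × X)) (hRclosed : IsClosed R)
    (hdom : ∀ x : X, ∃ y : X, (x, y) ∈ R) (hran : ∀ y : X, ∃ x : X, (x, y) ∈ R) :
    (∀ f : X ≃ₜ X, ∀ p ∈ R, (f p.1, f p.2) ∈ R) ↔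
      R = Set.diagonal X ∨ R = Set.univ := by
  constructor
  swap
  · rintro (rfl | rfl) f p hp
    · simp only [Set.mem_diagonal_iff] at hp ⊢
      rw [hp]
    · trivial
  intro hinv
  by_cases hR : R ⊆ Set.diagonal X
  · left
    refine hR.antisymm ?_
    rintro ⟨x, y⟩ hxy
    obtain rfl : x = y := hxy
    obtain ⟨z, hz⟩ := hdom x
    obtain rfl : x = z := hR hz
    exact hz
  right
  obtain ⟨⟨a, b⟩, habR, hab⟩ := Set.not_subset.1 hR
  replace hab : a ≠ b := hab
  have key : ∀ U V : Set X, IsClopen U → IsClopen V → Disjoint U V → U.Nonempty → V.Nonempty →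
      ∃ p ∈ R, p.1 ∈ U ∧ p.2 ∈ V := by
    intro U V hU hV hd hUn hVn
    obtain ⟨f, hf, -⟩ := exists_move hX hab.symm hU hUn
    obtain ⟨g, hg, hg'⟩ := exists_move hX (f.injective.ne hab) hV hVn
    refine ⟨(g (f a), g (f b)), hinv g _ (hinv f _ habR), ?_, hg⟩
    change g (f a) ∈ U
    rwa [hg' (Set.disjoint_left.1 hd hf)]
  have hoff : ∀ u v : X, u ≠ v → (u, v) ∈ R := by
    intro u v huv
    rw [← hRclosed.closure_eq]
    refine ((hX.2.1.prod hX.2.1).mem_closure_iff).2 ?_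
    rintro _ ⟨U, hU, V, hV, rfl⟩ ⟨hu, hv⟩
    obtain ⟨C, hC, huC, hsub⟩ := hX.2.1.exists_subset_of_mem_open
      (u := {v}ᶜ) (a := u) huv isOpen_compl_singleton
    have hC : IsClopen C := hC
    obtain ⟨p, hp, h1, h2⟩ := key (U ∩ C) (V ∩ Cᶜ) (IsClopen.inter hU hC)
      (IsClopen.inter hV hC.compl)
      (Set.disjoint_left.2 fun x hx hx' => hx'.2 hx.2) ⟨u, hu, huC⟩
      ⟨v, hv, fun h => hsub h rfl⟩
    exact ⟨p, ⟨h1.1, h2.1⟩, hp⟩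
  rw [Set.eq_univ_iff_forall]
  rintro ⟨u, v⟩
  by_cases huv : u = v
  swap
  · exact hoff u v huv
  subst huv
  rw [← hRclosed.closure_eq]
  refine ((hX.2.1.prod hX.2.1).mem_closure_iff).2 ?_
  rintro _ ⟨U, hU, V, hV, rfl⟩ ⟨hu, hv⟩
  obtain ⟨e⟩ := hX.2.2 Set.univ (U ∩ V) isClopen_univ (IsClopen.inter hU hV) ⟨u, trivial⟩
    ⟨u, hu, hv⟩
  refine ⟨((e ⟨a, trivial⟩ : X), (e ⟨b, trivial⟩ : X)), ⟨(e _).2.1, (e _).2.2⟩, hoff _ _ ?_⟩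
  intro h
  exact hab (congrArg Subtype.val (e.injective (Subtype.ext h)))
end

section
/- Let X be an h-homogeneous compact Hausdorff space and G = Aut(X) with the compact-open topology. Then G has no compact normal subgroups other than the trivial subgroup {id}. -/
open Set TopologicalSpace Filter

theorem aux_map {X : Type*} [TopologicalSpace X] (hX : IsHHomogeneous X) (A V : Set X)
    (hA : IsClopen A) (hV : IsClopen V) (nA : A.Nonempty) (nV : V.Nonempty) :
    ∃ e : X → X, ContinuousOn e A ∧ BijOn e A V := by
  classical
  obtain ⟨e⟩ := hX.2.2 A V hA hV nA nV
  refine ⟨fun x => if h : x ∈ A then (e ⟨x, h⟩ : X) else x, ?_, ?_, ?_, ?_⟩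
  · rw [continuousOn_iff_continuous_domRestrict]
    have : A.domRestrict (fun x => if h : x ∈ A then (e ⟨x, h⟩ : X) else x)
        = fun a => (e a : X) := by
      funext a
      simp [Set.domRestrict]
    rw [this]
    exact continuous_subtype_val.comp e.continuous
  · intro x hx
    simp [hx]
  · intro x hx y hy h
    simp only [hx, hy, dif_pos] at h
    have := e.injective (Subtype.ext h)
    simpa using this
  · intro y hy
    refine ⟨e.symm ⟨y, hy⟩, (e.symm ⟨y, hy⟩).2, ?_⟩
    simp

theorem aux_glue {X : Type*} [TopologicalSpace X] [CompactSpace X] [T2Space X]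
    (hX : IsHHomogeneous X) (U A V : Set X)
    (hU : IsClopen U) (hA : IsClopen A) (hV : IsClopen V) (nA : A.Nonempty) (nV : V.Nonempty)
    (dA : Disjoint U A) (dV : Disjoint U V)
    (cA : ((U ∪ A)ᶜ).Nonempty) (cV : ((U ∪ V)ᶜ).Nonempty) :
    ∃ h : X ≃ₜ X, (∀ x ∈ U, h x = x) ∧ h '' A = V := by
  classical
  obtain ⟨e, ce, me, ie, se⟩ := aux_map hX A V hA hV nA nV
  obtain ⟨k, ck, mk, ik, sk⟩ := aux_map hX _ _ (hU.union hA).compl (hU.union hV).compl cA cV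
  rw [Set.disjoint_left] at dA dV
  let φ : X → X := fun x => if x ∈ U then x else if x ∈ A then e x else k x
  have φU : ∀ x ∈ U, φ x = x := fun x hx => by simp [φ, hx]
  have φA : ∀ x ∈ A, φ x = e x := fun x hx => by
    have : x ∉ U := fun h => dA h hx
    simp [φ, hx, this]
  have φB : ∀ x ∈ (U ∪ A)ᶜ, φ x = k x := fun x hx => by
    have h1 : x ∉ U := fun h => hx (Or.inl h)
    have h2 : x ∉ A := fun h => hx (Or.inr h)
    simp [φ, h1, h2]
  have cov : ∀ x, x ∈ U ∨ x ∈ A ∨ x ∈ (U ∪ A)ᶜ := fun x => by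
    simp only [mem_compl_iff, mem_union]; tauto
  have mk' : ∀ x ∈ (U ∪ A)ᶜ, k x ∉ U ∧ k x ∉ V := fun x hx => by
    have := mk hx
    simp only [mem_compl_iff, mem_union] at this; tauto
  have cont : Continuous φ := by
    rw [continuous_iff_continuousAt]
    intro x
    rcases cov x with hx | hx | hx
    · exact (continuousOn_id.congr φU).continuousAt (hU.isOpen.mem_nhds hx)
    · exact (ce.congr φA).continuousAt (hA.isOpen.mem_nhds hx)
    · exact (ck.congr φB).continuousAt ((hU.union hA).compl.isOpen.mem_nhds hx)
  have inj : Function.Injective φ := by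
    intro x y h
    rcases cov x with hx | hx | hx <;> rcases cov y with hy | hy | hy
    · rwa [φU x hx, φU y hy] at h
    · rw [φU x hx, φA y hy] at h
      exact (dV (h ▸ hx) (me hy)).elim
    · rw [φU x hx, φB y hy] at h
      exact ((mk' y hy).1 (h ▸ hx)).elim
    · rw [φA x hx, φU y hy] at h
      exact (dV (h ▸ hy) (me hx)).elim
    · rw [φA x hx, φA y hy] at h
      exact ie hx hy h
    · rw [φA x hx, φB y hy] at h
      exact ((mk' y hy).2 (h ▸ me hx)).elim
    · rw [φB x hx, φU y hy] at h
      exact ((mk' x hx).1 (h ▸ hy)).elim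
    · rw [φB x hx, φA y hy] at h
      exact ((mk' x hx).2 (h ▸ me hy)).elim
    · rw [φB x hx, φB y hy] at h
      exact ik hx hy h
  have surj : Function.Surjective φ := by
    intro y
    by_cases h1 : y ∈ U
    · exact ⟨y, φU y h1⟩
    by_cases h2 : y ∈ V
    · obtain ⟨x, hx, rfl⟩ := se h2
      exact ⟨x, φA x hx⟩
    · obtain ⟨x, hx, rfl⟩ := sk (show y ∈ (U ∪ V)ᶜ from fun h => h.elim h1 h2)
      exact ⟨x, φB x hx⟩
  let h : X ≃ₜ X := Continuous.homeoOfEquivCompactToT2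
    (f := Equiv.ofBijective φ ⟨inj, surj⟩) cont
  refine ⟨h, φU, ?_⟩
  change φ '' A = V
  rw [Set.image_congr φA]
  exact (BijOn.image_eq ⟨me, ie, se⟩)

theorem aux_finite {X : Type*} [TopologicalSpace X] [CompactSpace X] [T2Space X]
    (N : Set (X ≃ₜ X)) (hN : IsCompact N) (U : Set X) (hU : IsClopen U) :
    ((fun f : X ≃ₜ X => f '' U) '' N).Finite := by
  classical
  obtain ⟨t, -, ht⟩ := hN.elim_nhds_subcover
    (fun f => {k : X ≃ₜ X | k '' U = f '' U}) (fun f _ => by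
      have hV : IsClopen (f '' U) := ⟨f.isClosedMap _ hU.1, f.isOpenMap _ hU.2⟩
      have o1 : IsOpen {k : X ≃ₜ X | MapsTo k U (f '' U)} :=
        (ContinuousMap.isOpen_setOfPred_mapsTo hU.1.isCompact hV.2).preimage continuous_induced_dom
      have o2 : IsOpen {k : X ≃ₜ X | MapsTo k Uᶜ (f '' U)ᶜ} :=
        (ContinuousMap.isOpen_setOfPred_mapsTo hU.compl.1.isCompact hV.compl.2).preimage
          continuous_induced_dom
      refine mem_of_superset ((o1.inter o2).mem_nhds ⟨mapsTo_image f U, ?_⟩) ?_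
      · intro x hx h
        exact hx ((f.injective.mem_set_image).1 h)
      · rintro k ⟨h1, h2⟩
        refine Subset.antisymm h1.image_subset ?_
        intro y hy
        obtain ⟨x, rfl⟩ := k.surjective y
        by_contra hx
        exact h2 (fun h => hx (mem_image_of_mem _ h)) hy)
  refine (t.finite_toSet.image (fun f : X ≃ₜ X => f '' U)).subset ?_
  rintro _ ⟨k, hk, rfl⟩
  obtain ⟨f, hf, hkf⟩ := mem_iUnion₂.1 (ht hk)
  exact ⟨f, hf, (show k '' U = f '' U from hkf).symm⟩

/-- The group of self-homeomorphisms of an h-homogeneous compact Hausdorff space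
(with the compact-open topology) has no compact normal subgroups other than the
trivial subgroup. -/
theorem compact_normal_subgroup_trivial
    {X : Type*} [TopologicalSpace X] [CompactSpace X] [T2Space X]
    (hX : IsHHomogeneous X)
    (N : Subgroup (X ≃ₜ X)) (hN : N.Normal) (hNcompact : IsCompact (N : Set (X ≃ₜ X))) :
    N = ⊥ := by
  rw [Subgroup.eq_bot_iff_forall]
  intro g hg
  by_contra hne
  obtain ⟨x, hx⟩ : ∃ x, g x ≠ x := by
    by_contra hcon
    push Not at hcon
    exact hne (Homeomorph.ext hcon)
  -- no isolated points
  have iso : ∀ p : X, ¬ IsOpen ({p} : Set X) := by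
    intro p hp
    obtain ⟨e⟩ := hX.2.2 {p} univ ⟨isClosed_singleton, hp⟩ isClopen_univ ⟨p, rfl⟩ ⟨p, trivial⟩
    have : e.symm ⟨g x, trivial⟩ = e.symm ⟨x, trivial⟩ := Subsingleton.elim _ _
    exact hx (congrArg Subtype.val (e.symm.injective this))
  have basis : ∀ (p : X) (O : Set X), IsOpen O → p ∈ O → ∃ W, IsClopen W ∧ p ∈ W ∧ W ⊆ O := by
    intro p O hO hp
    obtain ⟨W, h1, h2, h3⟩ := hX.2.1.exists_subset_of_mem_open hp hO
    exact ⟨W, h1, h2, h3⟩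
  have shrink : ∀ (p : X) (O : Set X), IsOpen O → p ∈ O → ∃ q ∈ O, q ≠ p := by
    intro p O hO hp
    by_contra hcon
    push Not at hcon
    apply iso p
    have : O = {p} := Subset.antisymm hcon (by simpa using hp)
    rwa [← this]
  obtain ⟨y, hy1, hy2⟩ := shrink x {g x}ᶜ isOpen_compl_singleton (fun h => hx h.symm)
  obtain ⟨P, Q, oP, oQ, hP, hQ, hPQ⟩ := t2_separation hx
  obtain ⟨U, hU, xU, hUO⟩ := basis x ((Q ∩ g ⁻¹' P) ∩ ({y}ᶜ ∩ g ⁻¹' {y}ᶜ))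
    ((oQ.inter (oP.preimage g.continuous)).inter
      (isOpen_compl_singleton.inter (isOpen_compl_singleton.preimage g.continuous)))
    ⟨⟨hQ, hP⟩, fun h => hy2 h.symm, fun h => hy1 h.symm⟩
  have hA : IsClopen (g '' U) := ⟨g.isClosedMap _ hU.1, g.isOpenMap _ hU.2⟩
  have dA : Disjoint U (g '' U) := by
    rw [Set.disjoint_left]
    rintro z hz ⟨w, hw, rfl⟩
    exact Set.disjoint_left.1 hPQ (hUO hw).1.2 (hUO hz).1.1
  have yA : y ∉ U ∪ g '' U := by
    rintro (h | ⟨w, hw, h⟩)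
    · exact (hUO h).2.1 rfl
    · exact (hUO hw).2.2 h
  have gA : g x ∈ g '' U := mem_image_of_mem _ xU
  have fin := aux_finite (N : Set (X ≃ₜ X)) hNcompact U hU
  have key : ∀ V, IsClopen V → g x ∈ V → V ⊆ g '' U →
      V ∈ (fun f : X ≃ₜ X => f '' U) '' (N : Set (X ≃ₜ X)) := by
    intro V hV hgV hVA
    obtain ⟨h, h1, h2⟩ := aux_glue hX U (g '' U) V hU hA hV ⟨_, gA⟩ ⟨_, hgV⟩ dA
      (dA.mono_right hVA) ⟨y, yA⟩ ⟨y, fun hh => yA (hh.imp id (fun z => hVA z))⟩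
    refine ⟨h * g * h⁻¹, hN.conj_mem g hg h, ?_⟩
    have h3 : ∀ z ∈ U, h.symm z = z := fun z hz => by
      rw [Homeomorph.symm_apply_eq, h1 z hz]
    rw [← h2, Set.image_image]
    refine Set.image_congr fun z hz => ?_
    change h (g (h.symm z)) = _
    rw [h3 z hz]
  let F : Set (Set X) := {V | V ∈ (fun f : X ≃ₜ X => f '' U) '' (N : Set (X ≃ₜ X)) ∧ g x ∈ V}
  have Ffin : F.Finite := fin.subset fun V hV => hV.1
  have oW : IsOpen (⋂₀ F) := Ffin.isOpen_sInter (by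
    rintro _ ⟨⟨f, -, rfl⟩, -⟩
    exact f.isOpenMap _ hU.2)
  obtain ⟨w, hw, hwne⟩ := shrink (g x) (⋂₀ F) oW (fun V hV => hV.2)
  obtain ⟨V, hV, hgV, hVO⟩ := basis (g x) (⋂₀ F ∩ {w}ᶜ) (oW.inter isOpen_compl_singleton)
    ⟨fun V hV => hV.2, fun h => hwne h.symm⟩
  have AF : g '' U ∈ F := ⟨⟨g, hg, rfl⟩, gA⟩
  have VF : V ∈ F := ⟨key V hV hgV (fun z hz => (hVO hz).1 _ AF), hgV⟩
  exact (hVO (hw V VF)).2 rfl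
end
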